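/- arXiv:1910.04126 — 2 statements merged into one kernel-verified Lean document; each statement's English description precedes it below -/
import Mathlib

section
/- Let d ∈ ℕ, let M be an integer, and let σ ∈ ℝ^d be random with i.i.d. coordinates uniformly distributed on [0, 2^M]. Let S₁, S₂ ⊆ ℝ^d be finite nonempty sets, let δ ∈ (0,1), and set λ = ln(|S₁|·|S₂|/δ). Assume λ ≥ 1 and ‖x−y‖₁ ≤ λ·2^M for all x ∈ S₁, y ∈ S₂. Then with probability at least 1−δ over σ, simultaneously every pair x ∈ S₁, y ∈ S₂ satisfies T_σ(x,y) ≥ ‖x−y‖₁/λ. -/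
open MeasureTheory
open scoped Classical

/-- The uniform probability measure on the interval `[0, t]`. -/
noncomputable def unif (t : ℝ) : Measure ℝ :=
  (ENNReal.ofReal t)⁻¹ • volume.restrict (Set.Icc 0 t)

/-- `x` and `y` are separated at level `ℓ` under the shift `σ`: some coordinate of their
grid cells of side `2^ℓ` (after shifting by `σ`) differs. -/
def Separated (d : ℕ) (σ : Fin d → ℝ) (ℓ : ℤ) (x y : Fin d → ℝ) : Prop :=
  ∃ i, ⌊(x i + σ i) / (2 : ℝ) ^ ℓ⌋ ≠ ⌊(y i + σ i) / (2 : ℝ) ^ ℓ⌋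

/-- The quadtree distance `T_σ(x,y) = 2 ⬝ Σ_{ℓ ≤ M} 2^ℓ ⬝ 1[x, y separated at level ℓ]`. -/
noncomputable def quadDist (d : ℕ) (M : ℤ) (σ x y : Fin d → ℝ) : ℝ :=
  2 * ∑' ℓ : ℤ, if ℓ ≤ M ∧ Separated d σ ℓ x y then (2 : ℝ) ^ ℓ else 0

/-- A measurable set of period `h` fills at most `n • v` of a stretch of `n` periods, as soon as it
fills at most `v` of one period. -/
lemma volume_real_inter_Ioc_le_of_periodic {A : Set ℝ} (hA : MeasurableSet A) {h : ℝ} (hh : 0 < h)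
    (hper : ∀ s, s + h ∈ A ↔ s ∈ A) (n : ℕ) (a c v : ℝ)
    (hv : volume.real (A ∩ Set.Ioc c (c + h)) ≤ v) :
    volume.real (A ∩ Set.Ioc a (a + n * h)) ≤ n * v := by
  have hf : Function.Periodic (A.indicator fun _ => (1 : ℝ)) h := fun s => by
    simp only [Set.indicator, hper]
  have hint : ∀ p q : ℝ, p ≤ q →
      ∫ s in p..q, A.indicator (fun _ => (1 : ℝ)) s = volume.real (A ∩ Set.Ioc p q) := by
    intro p q hpq
    rw [intervalIntegral.integral_of_le hpq, integral_indicator_const _ hA, smul_eq_mul, mul_one,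
      measureReal_restrict_apply hA]
  have key := hf.intervalIntegral_add_zsmul_eq n a fun p q => by
    rw [intervalIntegrable_iff]
    exact (integrableOn_const (by simp)).indicator hA
  rw [hf.intervalIntegral_add_eq a c, zsmul_eq_mul, zsmul_eq_mul,
    hint _ _ (by simp; positivity), hint _ _ (by linarith)] at key
  push_cast at key
  rw [key]
  gcongr

lemma volume_real_floor_eq_le {a b h : ℝ} (hh : 0 < h) (n : ℕ) :
    volume.real ({s | ⌊(a + s) / h⌋ = ⌊(b + s) / h⌋} ∩ Set.Ioc 0 (n * h)) ≤
      n * (h * Real.exp (-((b - a) / h))) := by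
  have hA : MeasurableSet {s : ℝ | ⌊(a + s) / h⌋ = ⌊(b + s) / h⌋} :=
    measurableSet_eq_fun (by fun_prop) (by fun_prop)
  have hper : ∀ s, s + h ∈ {s : ℝ | ⌊(a + s) / h⌋ = ⌊(b + s) / h⌋} ↔
      s ∈ {s : ℝ | ⌊(a + s) / h⌋ = ⌊(b + s) / h⌋} := fun s => by
    simp only [Set.mem_ofPred_eq, ← add_assoc, add_div _ h h, div_self hh.ne', Int.floor_add_one,
      add_left_inj]
  have hexp := Real.add_one_le_exp (-((b - a) / h))
  have hone := volume_real_inter_Ioc_le_of_periodic hA hh hper n 0 (-a)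
    (h * Real.exp (-((b - a) / h))) ?_
  · simpa using hone
  have hsub : {s : ℝ | ⌊(a + s) / h⌋ = ⌊(b + s) / h⌋} ∩ Set.Ioc (-a) (-a + h) ⊆
      Set.Ioo (-a) (-b + h) ∪ {-a + h} := by
    rintro s ⟨hs, h1, h2⟩
    rcases h2.eq_or_lt with h2 | h2
    · exact Or.inr h2
    · refine Or.inl ⟨h1, ?_⟩
      have h0 : ⌊(a + s) / h⌋ = 0 := by
        rw [Int.floor_eq_zero_iff]
        exact ⟨div_nonneg (by linarith) hh.le, (div_lt_one hh).2 (by linarith)⟩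
      have hb := (Int.floor_eq_zero_iff.1 (hs.symm.trans h0)).2
      have := (div_lt_one hh).1 hb
      linarith
  calc _ ≤ volume.real (Set.Ioo (-a) (-b + h) ∪ {-a + h}) := by
        refine measureReal_mono hsub ?_
        exact ((measure_union_le _ _).trans_lt (by simp)).ne
    _ ≤ volume.real (Set.Ioo (-a) (-b + h)) + volume.real {-a + h} := measureReal_union_le _ _
    _ = max (h * (-((b - a) / h) + 1)) 0 := by
        rw [Real.volume_real_Ioo]
        simp only [measureReal_def, Real.volume_singleton, ENNReal.toReal_zero, add_zero]
        congr 1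
        field_simp
        ring
    _ ≤ _ := max_le (by gcongr) (by positivity)

lemma unif_floor_eq_le {M ℓ : ℤ} (hℓ : ℓ ≤ M) (a b : ℝ) :
    unif (2 ^ M) {s | ⌊(a + s) / (2 : ℝ) ^ ℓ⌋ = ⌊(b + s) / (2 : ℝ) ^ ℓ⌋} ≤
      ENNReal.ofReal (Real.exp (-(|a - b| / (2 : ℝ) ^ ℓ))) := by
  wlog hab : a ≤ b generalizing a b
  · simpa only [eq_comm, abs_sub_comm] using this b a (le_of_not_ge hab)
  obtain ⟨n, rfl⟩ := Int.le.dest hℓ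
  have hh : (0 : ℝ) < 2 ^ ℓ := by positivity
  have hM : (2 : ℝ) ^ (ℓ + n) = (2 ^ n : ℕ) * 2 ^ ℓ := by
    rw [zpow_add₀ two_ne_zero]
    push_cast
    rw [zpow_natCast, mul_comm]
  have hreal := volume_real_floor_eq_le (a := a) (b := b) hh (2 ^ n)
  rw [← hM, ← mul_assoc, ← hM] at hreal
  rw [unif, Measure.smul_apply, smul_eq_mul, Measure.restrict_congr_set Ioc_ae_eq_Icc.symm,
    Measure.restrict_apply' measurableSet_Ioc, abs_sub_comm, abs_of_nonneg (sub_nonneg.2 hab)]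
  have hfin : volume ({s | ⌊(a + s) / (2 : ℝ) ^ ℓ⌋ = ⌊(b + s) / (2 : ℝ) ^ ℓ⌋} ∩
      Set.Ioc 0 (2 ^ (ℓ + n) : ℝ)) ≠ ⊤ :=
    ((measure_mono Set.inter_subset_right).trans_lt (by simp)).ne
  rw [mul_comm, ← div_eq_mul_inv]
  refine ENNReal.div_le_of_le_mul' ?_
  rw [← ENNReal.ofReal_mul (by positivity)]
  exact ENNReal.le_ofReal_iff_toReal_le hfin (by positivity) |>.2 hreal

instance isProbabilityMeasure_unif_zpow (M : ℤ) : IsProbabilityMeasure (unif (2 ^ M)) := by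
  have hM : (0 : ℝ) < 2 ^ M := by positivity
  refine ⟨?_⟩
  simp only [unif, Measure.smul_apply, Measure.restrict_apply_univ, Real.volume_Icc, sub_zero,
    smul_eq_mul]
  exact ENNReal.inv_mul_cancel (by simpa using hM) ENNReal.ofReal_ne_top

lemma pi_unif_not_separated_le (d : ℕ) {M ℓ : ℤ} (hℓ : ℓ ≤ M) (x y : Fin d → ℝ) :
    (Measure.pi fun _ : Fin d => unif ((2 : ℝ) ^ M)) {σ | ¬ Separated d σ ℓ x y} ≤
      ENNReal.ofReal (Real.exp (-((∑ i, |x i - y i|) / (2 : ℝ) ^ ℓ))) := by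
  have hset : {σ | ¬ Separated d σ ℓ x y} = Set.univ.pi fun i =>
      {s | ⌊(x i + s) / (2 : ℝ) ^ ℓ⌋ = ⌊(y i + s) / (2 : ℝ) ^ ℓ⌋} := by
    ext σ
    simp [Separated, Set.mem_pi]
  rw [hset, Measure.pi_pi, Finset.sum_div, ← Finset.sum_neg_distrib, Real.exp_sum,
    ENNReal.ofReal_prod_of_nonneg fun _ _ => (Real.exp_pos _).le]
  exact Finset.prod_le_prod' fun i _ => unif_floor_eq_le hℓ _ _

lemma quadDist_nonneg (d : ℕ) (M : ℤ) (σ x y : Fin d → ℝ) : 0 ≤ quadDist d M σ x y := by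
  unfold quadDist
  refine mul_nonneg zero_le_two (tsum_nonneg fun ℓ => ?_)
  split_ifs <;> positivity

lemma summable_ite_zpow_of_le (M : ℤ) (p : ℤ → Prop) [DecidablePred p] :
    Summable fun ℓ : ℤ => if ℓ ≤ M ∧ p ℓ then (2 : ℝ) ^ ℓ else 0 := by
  have hinj : Function.Injective fun k : ℕ => M - (k : ℤ) := fun i j hij => by
    simpa using hij
  refine (hinj.summable_iff ?_).1 ?_
  · intro ℓ hℓ
    refine if_neg fun h => hℓ ⟨(M - ℓ).toNat, ?_⟩
    have := h.1
    simp only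
    omega
  · refine Summable.of_nonneg_of_le (f := fun k : ℕ => (2 : ℝ) ^ M * (1 / 2) ^ k)
      (fun k => ?_) (fun k => ?_) (summable_geometric_two.mul_left _)
    · simp only [Function.comp]
      split_ifs <;> positivity
    · have : (2 : ℝ) ^ (M - (k : ℤ)) = 2 ^ M * (1 / 2) ^ k := by
        rw [zpow_sub₀ two_ne_zero, zpow_natCast, one_div, inv_pow, div_eq_mul_inv]
      simp only [Function.comp, this]
      split_ifs
      · exact le_rfl
      · positivity

lemma two_mul_zpow_le_quadDist {d : ℕ} {M ℓ : ℤ} (hℓ : ℓ ≤ M) {σ x y : Fin d → ℝ}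
    (h : Separated d σ ℓ x y) : 2 * (2 : ℝ) ^ ℓ ≤ quadDist d M σ x y := by
  unfold quadDist
  gcongr
  have hle := (summable_ite_zpow_of_le M fun ℓ => Separated d σ ℓ x y).le_tsum ℓ
    fun k _ => by split_ifs <;> positivity
  rwa [if_pos ⟨hℓ, h⟩] at hle

/-- A single pair is contracted by more than a factor `lam` with probability at most
`exp (-lam)`. -/
lemma pi_unif_quadDist_lt_le (d : ℕ) (M : ℤ) (x y : Fin d → ℝ) {lam : ℝ} (hlam : 0 < lam)
    (hdist : ∑ i, |x i - y i| ≤ lam * (2 : ℝ) ^ M) :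
    (Measure.pi fun _ : Fin d => unif ((2 : ℝ) ^ M))
      {σ | quadDist d M σ x y < (∑ i, |x i - y i|) / lam} ≤
      ENNReal.ofReal (Real.exp (-lam)) := by
  have hD0 : 0 ≤ ∑ i, |x i - y i| := Finset.sum_nonneg fun _ _ => abs_nonneg _
  generalize hD : ∑ i, |x i - y i| = D at *
  rcases hD0.eq_or_lt with rfl | hpos
  · have : {σ | quadDist d M σ x y < 0 / lam} = ∅ := by
      ext σ
      simpa using quadDist_nonneg d M σ x y
    rw [this, measure_empty]
    exact zero_le
  obtain ⟨ℓ, hlow, hup⟩ := exists_mem_Ico_zpow (div_pos hpos hlam) one_lt_two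
  have hℓ : ℓ ≤ M := by
    refine (zpow_le_zpow_iff_right₀ (one_lt_two (α := ℝ))).1 (hlow.trans ?_)
    rwa [div_le_iff₀' hlam]
  have hsub : {σ | quadDist d M σ x y < D / lam} ⊆ {σ | ¬ Separated d σ ℓ x y} := by
    intro σ hσ hsep
    have h1 := two_mul_zpow_le_quadDist hℓ hsep
    rw [zpow_add_one₀ two_ne_zero] at hup
    have : quadDist d M σ x y < D / lam := hσ
    linarith
  refine (measure_mono hsub).trans ((pi_unif_not_separated_le d hℓ x y).trans ?_)
  rw [hD]
  refine ENNReal.ofReal_le_ofReal (Real.exp_le_exp.2 (neg_le_neg ?_))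
  rw [le_div_iff₀ (by positivity)]
  rwa [le_div_iff₀' hlam] at hlow

/-- Union bound over pairs: for finite nonempty `S₁, S₂ ⊆ ℝ^d`, `δ ∈ (0,1)` and
`λ = ln(|S₁|·|S₂|/δ)` with `λ ≥ 1` and all pairwise ℓ₁-distances at most `λ·2^M`,
with probability at least `1−δ` over the uniform shift `σ`, simultaneously every pair
`x ∈ S₁, y ∈ S₂` satisfies `T_σ(x,y) ≥ ‖x−y‖₁/λ`. -/
theorem stmt5 (d : ℕ) (M : ℤ) (S₁ S₂ : Finset (Fin d → ℝ))
    (hS₁ : S₁.Nonempty) (hS₂ : S₂.Nonempty)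
    (δ : ℝ) (hδ : δ ∈ Set.Ioo (0 : ℝ) 1)
    (lam : ℝ) (hlam : lam = Real.log ((S₁.card : ℝ) * (S₂.card : ℝ) / δ))
    (hlam1 : 1 ≤ lam)
    (hdist : ∀ x ∈ S₁, ∀ y ∈ S₂, ∑ i, |x i - y i| ≤ lam * (2 : ℝ) ^ M) :
    ENNReal.ofReal (1 - δ) ≤
      (Measure.pi fun _ : Fin d => unif ((2 : ℝ) ^ M))
        {σ : Fin d → ℝ | ∀ x ∈ S₁, ∀ y ∈ S₂,
          (∑ i, |x i - y i|) / lam ≤ quadDist d M σ x y} := by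
  set μ := Measure.pi fun _ : Fin d => unif ((2 : ℝ) ^ M)
  set G := {σ : Fin d → ℝ | ∀ x ∈ S₁, ∀ y ∈ S₂, (∑ i, |x i - y i|) / lam ≤ quadDist d M σ x y}
  have hδ0 : 0 < δ := hδ.1
  have hc₁ : (0 : ℝ) < S₁.card := by exact_mod_cast hS₁.card_pos
  have hc₂ : (0 : ℝ) < S₂.card := by exact_mod_cast hS₂.card_pos
  have hexp : (S₁.card : ℝ) * S₂.card * Real.exp (-lam) = δ := by
    rw [hlam, Real.exp_neg, Real.exp_log (by positivity)]
    field_simp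
  have hbad : μ Gᶜ ≤ ENNReal.ofReal δ := by
    have hsub : Gᶜ ⊆ ⋃ p ∈ S₁ ×ˢ S₂,
        {σ | quadDist d M σ p.1 p.2 < (∑ i, |p.1 i - p.2 i|) / lam} := by
      intro σ hσ
      simp only [G, Set.mem_compl_iff, Set.mem_ofPred_eq, not_forall, not_le] at hσ
      obtain ⟨x, hx, y, hy, hxy⟩ := hσ
      exact Set.mem_biUnion (x := (x, y)) (Finset.mem_product.2 ⟨hx, hy⟩) hxy
    refine (measure_mono hsub).trans ((measure_biUnion_finset_le _ _).trans ?_)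
    refine (Finset.sum_le_card_nsmul _ _ _ fun p hp => ?_).trans_eq
      (b := (S₁ ×ˢ S₂).card • ENNReal.ofReal (Real.exp (-lam))) ?_
    · obtain ⟨hx, hy⟩ := Finset.mem_product.1 hp
      exact pi_unif_quadDist_lt_le d M p.1 p.2 (by linarith) (hdist _ hx _ hy)
    · rw [← ENNReal.ofReal_nsmul, Finset.card_product, nsmul_eq_mul]
      push_cast
      rw [hexp]
  have hcover : 1 ≤ μ G + μ Gᶜ := by
    rw [← measure_univ (μ := μ), ← Set.union_compl_self G]
    exact measure_union_le _ _
  rw [ENNReal.ofReal_sub _ hδ0.le, ENNReal.ofReal_one]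
  exact tsub_le_iff_right.2 (hcover.trans (by gcongr))
end

section
/- Let d ≥ 2 be an even integer, let M ≥ 1 be an integer, and let σ ∈ ℝ^d be random with i.i.d. coordinates uniformly distributed on [0, 2^M]. Let X = {0, e₁} ∪ {z ∈ {0,1}^d : Σ_i z_i = d/2} ⊂ ℝ^d, where e₁ is the first standard basis vector. Then with probability at least 1/2 over σ, there exists z* ∈ X with Σ_i z*_i = d/2 such that T_σ(0, z*) ≤ T_σ(0, x) for every x ∈ X∖{0}; in particular, the minimum of T_σ(0, ·) over X∖{0} is attained at a point at ℓ₁-distance d/2 from the query point 0, while the true ℓ₁-nearest neighbor e₁ is at distance 1. Consequently, since |X∖{0}| = n with n − 1 = binom(d, d/2) ≤ 2^d, the quadtree nearest-neighbor approximation factor on this instance is at least d/2 ≥ (1/2)·log₂(n−1). -/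
open MeasureTheory
open scoped Classical

/-- The set of 0/1 vectors of Hamming weight exactly `d/2`. -/
def hypercubeMid (d : ℕ) : Set (Fin d → ℝ) :=
  {z | (∀ i, z i = 0 ∨ z i = 1) ∧ ∑ i, z i = (d : ℝ) / 2}

/-- The first standard basis vector `e₁ ∈ ℝ^d`. -/
def e₁ (d : ℕ) : Fin d → ℝ := fun i => if (i : ℕ) = 0 then 1 else 0

/-- The hard instance `X = {0, e₁} ∪ {z ∈ {0,1}^d : Σᵢ zᵢ = d/2}`. -/
def Xhard (d : ℕ) : Set (Fin d → ℝ) :=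
  {0, e₁ d} ∪ hypercubeMid d

/-- A unit step from `s` crosses a boundary of the grid of side `2 ^ ℓ`. -/
def Crosses (s : ℝ) (ℓ : ℤ) : Prop :=
  ⌊s / (2 : ℝ) ^ ℓ⌋ ≠ ⌊(1 + s) / (2 : ℝ) ^ ℓ⌋

lemma Crosses.anti {s : ℝ} {k ℓ : ℤ} (hkℓ : k ≤ ℓ) (h : Crosses s ℓ) : Crosses s k := by
  obtain ⟨n, rfl⟩ := Int.le.dest hkℓ
  have coarsen (x : ℝ) : ⌊x / (2 : ℝ) ^ (k + n)⌋ = ⌊x / (2 : ℝ) ^ k⌋ / ((2 ^ n : ℕ) : ℤ) := by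
    rw [← Int.floor_div_natCast, div_div, zpow_add₀ two_ne_zero]
    simp
  intro hk
  exact h (by rw [coarsen, coarsen, hk])

lemma crosses_of_nonpos (s : ℝ) {ℓ : ℤ} (hℓ : ℓ ≤ 0) : Crosses s ℓ := by
  refine Crosses.anti hℓ ?_
  simp [Crosses, add_comm (1 : ℝ)]

/-- The number of levels in `[1, M]` whose grid is crossed by a unit step from `s`. -/
noncomputable def crossCount (M : ℤ) (s : ℝ) : ℕ :=
  ∑ ℓ ∈ Finset.Icc 1 M, if Crosses s ℓ then 1 else 0

lemma crosses_of_crossCount_le {M : ℤ} {s t : ℝ} (h : crossCount M s ≤ crossCount M t)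
    {ℓ : ℤ} (hℓ : ℓ ≤ M) (hs : Crosses s ℓ) : Crosses t ℓ := by
  by_contra ht
  have hpos : 1 ≤ ℓ := by
    by_contra! hneg
    exact ht (crosses_of_nonpos t (by omega))
  refine h.not_gt (Finset.sum_lt_sum (fun k _ => ?_) ⟨ℓ, by simp [hpos, hℓ], by simp [hs, ht]⟩)
  by_cases hk : Crosses t k
  · have hkℓ : k ≤ ℓ := by
      by_contra! hlt
      exact ht (hk.anti hlt.le)
    simp [hk, hs.anti hkℓ]
  · simp [hk]

lemma measurable_crossCount (M : ℤ) : Measurable (crossCount M) := by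
  refine Finset.measurable_fun_sum _ fun ℓ _ => Measurable.ite ?_ measurable_const measurable_const
  refine (measurableSet_eq_fun ?_ ?_).compl <;> fun_prop

lemma separated_zero_iff {d : ℕ} {σ z : Fin d → ℝ} (hz : ∀ i, z i = 0 ∨ z i = 1) (ℓ : ℤ) :
    Separated d σ ℓ 0 z ↔ ∃ i, z i = 1 ∧ Crosses (σ i) ℓ := by
  refine exists_congr fun i => ?_
  rcases hz i with h | h <;> simp [h, Crosses]

lemma summable_zpow_levels (M : ℤ) (p : ℤ → Prop) :
    Summable fun ℓ : ℤ => if ℓ ≤ M ∧ p ℓ then (2 : ℝ) ^ ℓ else 0 := by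
  have hnonneg (ℓ : ℤ) : 0 ≤ if ℓ ≤ M ∧ p ℓ then (2 : ℝ) ^ ℓ else 0 := by
    split_ifs <;> positivity
  apply Summable.of_nat_of_neg
  · refine summable_of_ne_finset_zero (s := Finset.range (M.toNat + 1)) fun n hn => ?_
    rw [if_neg]
    simp only [Finset.mem_range] at hn
    omega
  · refine Summable.of_nonneg_of_le (fun n => hnonneg _) (fun n => ?_) summable_geometric_two
    split_ifs
    · simp
    · positivity

lemma quadDist_le_of_separated {d : ℕ} {M : ℤ} {σ x y z w : Fin d → ℝ}
    (h : ∀ ℓ ≤ M, Separated d σ ℓ x y → Separated d σ ℓ z w) :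
    quadDist d M σ x y ≤ quadDist d M σ z w := by
  refine mul_le_mul_of_nonneg_left ?_ zero_le_two
  refine (summable_zpow_levels M _).tsum_le_tsum (fun ℓ => ?_) (summable_zpow_levels M _)
  by_cases hℓ : ℓ ≤ M ∧ Separated d σ ℓ x y
  · rw [if_pos hℓ, if_pos ⟨hℓ.1, h ℓ hℓ.1 hℓ.2⟩]
  · rw [if_neg hℓ]
    split_ifs <;> positivity

lemma finite_hypercubeMid (d : ℕ) : (hypercubeMid d).Finite := by
  refine (Set.Finite.pi (t := fun _ : Fin d => ({0, 1} : Set ℝ)) fun _ => by simp).subset ?_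
  intro z hz i _
  simpa using hz.1 i

lemma exists_nearest_mem_hypercubeMid {d : ℕ} (hd : Even d) {M : ℤ} {σ : Fin d → ℝ} {i₀ : Fin d}
    (hi₀ : (i₀ : ℕ) = 0)
    (hσ : d / 2 ≤ (Finset.univ.filter fun j => crossCount M (σ j) ≤ crossCount M (σ i₀)).card) :
    ∃ z ∈ hypercubeMid d, ∀ x ∈ Xhard d, x ≠ 0 → quadDist d M σ 0 z ≤ quadDist d M σ 0 x := by
  obtain ⟨S, hS, hcard⟩ := Finset.exists_subset_card_eq hσ
  let w : Fin d → ℝ := fun i => if i ∈ S then 1 else 0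
  have hw : w ∈ hypercubeMid d := by
    refine ⟨fun i => ?_, ?_⟩
    · by_cases h : i ∈ S <;> simp [w, h]
    · simp [w, hcard, Nat.cast_div hd.two_dvd]
  have hwe : quadDist d M σ 0 w ≤ quadDist d M σ 0 (e₁ d) := by
    refine quadDist_le_of_separated fun ℓ hℓ hsep => ?_
    obtain ⟨i, hi, hcross⟩ := (separated_zero_iff hw.1 ℓ).1 hsep
    have hiS : i ∈ S := by
      by_contra h
      simp [w, h] at hi
    refine (separated_zero_iff (fun j => ?_) ℓ).2 ⟨i₀, by simp [e₁, hi₀], ?_⟩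
    · by_cases h : (j : ℕ) = 0 <;> simp [e₁, h]
    · exact crosses_of_crossCount_le (Finset.mem_filter.1 (hS hiS)).2 hℓ hcross
  obtain ⟨z, hz, hmin⟩ :=
    Set.exists_min_image _ (quadDist d M σ 0) (finite_hypercubeMid d) ⟨w, hw⟩
  refine ⟨z, hz, fun x hx hx0 => ?_⟩
  rcases hx with (rfl | rfl) | hx
  · exact absurd rfl hx0
  · exact (hmin w hw).trans hwe
  · exact hmin x hx

lemma isProbabilityMeasure_unif {t : ℝ} (ht : 0 < t) : IsProbabilityMeasure (unif t) := by
  constructor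
  simp [unif, ENNReal.inv_mul_cancel (ENNReal.ofReal_pos.2 ht).ne' ENNReal.ofReal_ne_top]

/-- At least `n - k` elements of a finite family of size `n` dominate at least `k` elements. -/
lemma card_le_card_filter_rank_add {ι β : Type*} [Fintype ι] [LinearOrder β] (f : ι → β) (k : ℕ) :
    Fintype.card ι ≤
      (Finset.univ.filter fun i => k ≤ (Finset.univ.filter fun j => f j ≤ f i).card).card + k := by
  rw [← Finset.card_univ,
    ← Finset.card_filter_add_card_filter_not
      (fun i => k ≤ (Finset.univ.filter fun j => f j ≤ f i).card)]
  refine Nat.add_le_add_left ?_ _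
  set B := Finset.univ.filter fun i => ¬ k ≤ (Finset.univ.filter fun j => f j ≤ f i).card with hB
  rcases B.eq_empty_or_nonempty with h | h
  · simp [h]
  · obtain ⟨i, hi, hmax⟩ := B.exists_max_image f h
    have hsub : B ⊆ Finset.univ.filter fun j => f j ≤ f i := fun j hj => by simpa using hmax j hj
    have hlt := (Finset.mem_filter.1 hi).2
    exact (Finset.card_le_card hsub).trans (by omega)

/-- Among i.i.d. samples, all indices are equally likely to dominate at least `k` samples. -/
lemma measure_rank_ge_eq {ι α β : Type*} [Fintype ι] [MeasurableSpace α] [LinearOrder β]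
    (ν : Measure α) [IsProbabilityMeasure ν] (f : α → β) (k : ℕ) (i i' : ι) :
    (Measure.pi fun _ : ι => ν)
        {σ | k ≤ (Finset.univ.filter fun j => f (σ j) ≤ f (σ i)).card} =
      (Measure.pi fun _ : ι => ν)
        {σ | k ≤ (Finset.univ.filter fun j => f (σ j) ≤ f (σ i')).card} := by
  have hmp := measurePreserving_arrowCongr' (fun _ : ι => ν) (fun _ : ι => ν) (Equiv.swap i i')
    (MeasurableEquiv.refl α) fun _ => MeasurePreserving.id ν
  rw [← hmp.measure_preimage_equiv]
  congr 1
  ext σ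
  have hcomp (j : ι) : MeasurableEquiv.arrowCongr' (Equiv.swap i i') (MeasurableEquiv.refl α) σ j =
      σ (Equiv.swap i i' j) := rfl
  simp only [Set.mem_preimage, Set.mem_ofPred_eq, hcomp, Equiv.swap_apply_left]
  refine Eq.to_iff (congrArg (k ≤ ·) (Finset.card_equiv (Equiv.swap i i') fun j => ?_))
  simp

lemma half_le_measure_rank_ge {ι α : Type*} [Fintype ι] [MeasurableSpace α]
    (ν : Measure α) [IsProbabilityMeasure ν] {f : α → ℕ} (hf : Measurable f)
    (i₀ : ι) :
    ENNReal.ofReal (1 / 2) ≤ (Measure.pi fun _ : ι => ν)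
      {σ | Fintype.card ι / 2 ≤ (Finset.univ.filter fun j => f (σ j) ≤ f (σ i₀)).card} := by
  set k := Fintype.card ι / 2 with hk
  set A : ι → Set (ι → α) :=
    fun i => {σ | k ≤ (Finset.univ.filter fun j => f (σ j) ≤ f (σ i)).card} with hA
  have hmeas (i : ι) : MeasurableSet (A i) := by
    have hcard : Measurable fun σ : ι → α =>
        (Finset.univ.filter fun j => f (σ j) ≤ f (σ i)).card := by
      simp only [Finset.card_filter]
      refine Finset.measurable_fun_sum _ fun j _ =>
        Measurable.ite (measurableSet_le ?_ ?_) measurable_const measurable_const <;> fun_prop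
    exact measurableSet_le measurable_const hcard
  have hsum : ((Fintype.card ι - k : ℕ) : ENNReal) ≤
      Fintype.card ι * (Measure.pi fun _ : ι => ν) (A i₀) :=
    calc ((Fintype.card ι - k : ℕ) : ENNReal)
        = ∫⁻ _, ((Fintype.card ι - k : ℕ) : ENNReal) ∂(Measure.pi fun _ : ι => ν) := by simp
      _ ≤ ∫⁻ σ, ∑ i, (A i).indicator 1 σ ∂(Measure.pi fun _ : ι => ν) := by
          refine lintegral_mono fun σ => ?_
          have hrank := card_le_card_filter_rank_add (fun i => f (σ i)) k
          simp only [Set.indicator_apply, Pi.one_apply, Finset.sum_boole, hA, Set.mem_ofPred_eq]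
          exact_mod_cast Nat.sub_le_iff_le_add.2 hrank
      _ = ∑ i, (Measure.pi fun _ : ι => ν) (A i) := by
          rw [lintegral_finsetSum _ fun i _ => measurable_one.indicator (hmeas i)]
          simp only [lintegral_indicator_one (hmeas _)]
      _ = Fintype.card ι * (Measure.pi fun _ : ι => ν) (A i₀) := by
          rw [Finset.sum_congr rfl fun i _ => measure_rank_ge_eq ν f k i i₀]
          simp [hA]
  have hι : (0 : ℝ) < Fintype.card ι := by exact_mod_cast Fintype.card_pos_iff.2 ⟨i₀⟩
  rw [ENNReal.ofReal_le_iff_le_toReal (measure_ne_top _ _)]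
  have hreal := ENNReal.toReal_mono
    (ENNReal.mul_ne_top (ENNReal.natCast_ne_top _) (measure_ne_top _ _)) hsum
  rw [ENNReal.toReal_mul, ENNReal.toReal_natCast, ENNReal.toReal_natCast] at hreal
  have hhalf : (Fintype.card ι : ℝ) ≤ 2 * (Fintype.card ι - k : ℕ) := by
    exact_mod_cast (by omega : Fintype.card ι ≤ 2 * (Fintype.card ι - k))
  nlinarith

/-- The `Ω(log n)` lower bound instance for Quadtree: for even `d ≥ 2` and `M ≥ 1`,
with probability at least 1/2 over the random shift, the quadtree-nearest point to the
query `0` within `X ∖ {0}` is attained at some Hamming-weight-`d/2` point `z*`; such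
points lie at ℓ₁-distance `d/2` from `0`, whereas the true nearest neighbor `e₁` is at
ℓ₁-distance `1`; and `d/2 ≥ (1/2)·log₂(n−1)` where `n − 1 = binom(d, d/2)`. -/
theorem stmt11 (d : ℕ) (hd2 : 2 ≤ d) (hdeven : Even d) (M : ℤ) (hM : 1 ≤ M) :
    (ENNReal.ofReal (1 / 2) ≤
      (Measure.pi fun _ : Fin d => unif ((2 : ℝ) ^ M))
        {σ : Fin d → ℝ | ∃ z ∈ hypercubeMid d,
          ∀ x ∈ Xhard d, x ≠ 0 → quadDist d M σ 0 z ≤ quadDist d M σ 0 x}) ∧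
    (∀ z ∈ hypercubeMid d, ∑ i, |z i - (0 : Fin d → ℝ) i| = (d : ℝ) / 2) ∧
    (∑ i, |e₁ d i - (0 : Fin d → ℝ) i| = 1) ∧
    (1 / 2 * Real.logb 2 (d.choose (d / 2) : ℝ) ≤ (d : ℝ) / 2) := by
  have : NeZero d := ⟨by omega⟩
  refine ⟨?_, fun z hz => ?_, ?_, ?_⟩
  · have := isProbabilityMeasure_unif (t := (2 : ℝ) ^ M) (by positivity)
    refine (half_le_measure_rank_ge (unif ((2 : ℝ) ^ M)) (measurable_crossCount M)
      (0 : Fin d)).trans (measure_mono fun σ hσ => ?_)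
    exact exists_nearest_mem_hypercubeMid hdeven (i₀ := 0) (by simp) (by simpa using hσ)
  · rw [← hz.2]
    refine Finset.sum_congr rfl fun i _ => ?_
    rcases hz.1 i with h | h <;> simp [h]
  · rw [Finset.sum_eq_single (0 : Fin d)]
    · simp [e₁]
    · intro i _ hi
      simp [e₁, hi]
    · simp
  · have hchoose : (d.choose (d / 2) : ℝ) ≤ (2 : ℝ) ^ (d : ℝ) := by
      rw [Real.rpow_natCast]
      exact_mod_cast Nat.choose_le_two_pow d (d / 2)
    have hpos : (0 : ℝ) < d.choose (d / 2) := by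
      exact_mod_cast Nat.choose_pos (Nat.div_le_self d 2)
    have hlog := (Real.logb_le_iff_le_rpow one_lt_two hpos).2 hchoose
    linarith
end
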